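/- arXiv:1810.01542 — 2 statements merged into one kernel-verified Lean document; each statement's English description precedes it below -/
import Mathlib

section
/- Let G be a connected graph and let u, v be two distinct non-adjacent vertices of G. Then (u,v) is a P_3-suitable pair of G if and only if the graph G − {u,v} obtained from G by deleting u and v is nonempty and connected. -/
open SimpleGraph

/-- `f` is an `H`-witness structure of `G`: every bag `f x` is nonempty and induces a connected
subgraph of `G`, the bags partition the vertex set of `G`, and for distinct `x`, `y` there is
an edge of `G` between the bags `f x` and `f y` if and only if `x` and `y` are adjacent in `H`. -/
def IsWitnessStructure {V W : Type} (G : SimpleGraph V) (H : SimpleGraph W)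
    (f : W → Set V) : Prop :=
  (∀ x, (f x).Nonempty) ∧
  (∀ x, (G.induce (f x)).Connected) ∧
  (∀ v : V, ∃! x, v ∈ f x) ∧
  (∀ x y, x ≠ y → ((∃ a ∈ f x, ∃ b ∈ f y, G.Adj a b) ↔ H.Adj x y))

/-- `G` contains `H` as a contraction: `G` has an `H`-witness structure. -/
def ContainsAsContraction {V W : Type} (G : SimpleGraph V) (H : SimpleGraph W) : Prop :=
  ∃ f : W → Set V, IsWitnessStructure G H f

/-- `(u, v)` is a `P_k`-suitable pair of `G`: `G` has a `P_k`-witness structure whose bag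
at the first vertex of the path is `{u}` and whose bag at the last vertex is `{v}`. -/
def PkSuitable {V : Type} (k : ℕ) (G : SimpleGraph V) (u v : V) : Prop :=
  ∃ f : Fin k → Set V, IsWitnessStructure G (pathGraph k) f ∧
    (∀ i : Fin k, (i : ℕ) = 0 → f i = {u}) ∧
    (∀ i : Fin k, (i : ℕ) = k - 1 → f i = {v})
/-- In a connected graph, a vertex `a` distinct from and not adjacent to `b` has a neighbour
outside `{a, b}`. -/
theorem exists_adj_ne_of_not_adj {V : Type} {G : SimpleGraph V} (hG : G.Connected) {a b : V}
    (hne : a ≠ b) (hab : ¬ G.Adj a b) : ∃ c, c ≠ a ∧ c ≠ b ∧ G.Adj a c := by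
  obtain ⟨p⟩ := hG.preconnected a b
  cases p with
  | nil => exact absurd rfl hne
  | cons h q => exact ⟨_, h.ne', fun hc => hab (hc ▸ h), h⟩

theorem stmt_5 {V : Type} [Fintype V] (G : SimpleGraph V) (hconn : G.Connected)
    (u v : V) (huv : u ≠ v) (hadj : ¬ G.Adj u v) :
    PkSuitable 3 G u v ↔
      (({u, v}ᶜ : Set V).Nonempty ∧ (G.induce ({u, v}ᶜ : Set V)).Connected) := by
  constructor
  · rintro ⟨f, ⟨hne, hc, hpart, -⟩, hfirst, hlast⟩
    have h0 : f 0 = {u} := hfirst 0 rfl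
    have h2 : f 2 = {v} := hlast 2 rfl
    have h1 : f 1 = ({u, v}ᶜ : Set V) := by
      ext w
      obtain ⟨x, hx, hxu⟩ := hpart w
      constructor
      · intro hw
        have h1x : 1 = x := hxu 1 hw
        rintro (rfl | rfl)
        · have h0x : 0 = x := hxu 0 (by simp [h0])
          exact absurd (h0x.trans h1x.symm) (by decide)
        · have h2x : 2 = x := hxu 2 (by simp [h2])
          exact absurd (h2x.trans h1x.symm) (by decide)
      · intro hw
        fin_cases x <;> simp_all
    exact h1 ▸ ⟨hne 1, hc 1⟩
  · rintro ⟨hne, hc⟩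
    obtain ⟨a, hau, hav, hua⟩ := exists_adj_ne_of_not_adj hconn huv hadj
    obtain ⟨b, hbv, hbu, hvb⟩ :=
      exists_adj_ne_of_not_adj hconn huv.symm fun h => hadj h.symm
    have hadj' : ¬ G.Adj v u := fun h => hadj h.symm
    refine ⟨![{u}, {u, v}ᶜ, {v}], ⟨?_, ?_, ?_, ?_⟩, ?_, ?_⟩
    · intro x
      fin_cases x
      exacts [Set.singleton_nonempty u, hne, Set.singleton_nonempty v]
    · have hs (w : V) : (G.induce {w}).Connected := ⟨.of_subsingleton⟩
      intro x
      fin_cases x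
      exacts [hs u, hc, hs v]
    · intro w
      by_cases hwu : w = u
      · refine ⟨0, by simp [hwu], fun y hy => ?_⟩
        fin_cases y <;> simp_all
      · by_cases hwv : w = v
        · refine ⟨2, by simp [hwv], fun y hy => ?_⟩
          fin_cases y <;> simp_all
        · refine ⟨1, by simp [hwu, hwv], fun y hy => ?_⟩
          fin_cases y <;> simp_all
    · have hu : ∃ c, (c ≠ u ∧ c ≠ v) ∧ G.Adj u c := ⟨a, ⟨hau, hav⟩, hua⟩
      have hu' : ∃ c, (c ≠ u ∧ c ≠ v) ∧ G.Adj c u := ⟨a, ⟨hau, hav⟩, hua.symm⟩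
      have hv : ∃ c, (c ≠ u ∧ c ≠ v) ∧ G.Adj v c := ⟨b, ⟨hbu, hbv⟩, hvb⟩
      have hv' : ∃ c, (c ≠ u ∧ c ≠ v) ∧ G.Adj c v := ⟨b, ⟨hbu, hbv⟩, hvb.symm⟩
      intro x y hxy
      fin_cases x <;> fin_cases y <;> simp_all [pathGraph_adj]
    · intro i hi
      fin_cases i <;> simp_all
    · intro i hi
      fin_cases i <;> simp_all
end

section
/- Let p ≥ 4 be an even integer and let 𝓗 be a hypergraph in which every hyperedge is nonempty and S_n = Q. Then the graph \bar{G}_𝓗 is bipartite and has girth at least p; moreover, the distance between \bar{t}_1 and \bar{t}_2 in \bar{G}_𝓗 equals 2p−1. -/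
open SimpleGraph

/-- The vertices of the graph `G_𝓗` associated with a hypergraph with elements `q_1, …, q_m`
(represented by `Fin m`) and hyperedges `S_1, …, S_n` (represented by `Fin n`):
the elements `q x`, the hyperedge vertices `S j`, their copies `S' j`,
and two extra vertices `t1` and `t2`. -/
inductive HVert (m n : ℕ) : Type
  | q : Fin m → HVert m n
  | S : Fin n → HVert m n
  | S' : Fin n → HVert m n
  | t1 : HVert m n
  | t2 : HVert m n
  deriving DecidableEq

/-- The graph `G_𝓗` associated with the hypergraph `(Fin m, S)`: `q x` is adjacent to `S j`
and to `S' j` iff `x ∈ S j`; every `S j` is adjacent to every `S' l`; the elements form a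
clique; `t1` is adjacent to every `S j`; `t2` is adjacent to every `S' j`. -/
def GH (m n : ℕ) (S : Fin n → Set (Fin m)) : SimpleGraph (HVert m n) :=
  SimpleGraph.fromRel (fun a b =>
    match a, b with
    | .q _, .q _ => True
    | .q x, .S j => x ∈ S j
    | .q x, .S' j => x ∈ S j
    | .S _, .S' _ => True
    | .t1, .S _ => True
    | .t2, .S' _ => True
    | _, _ => False)

/-- The vertices of the graph `\bar{G}_𝓗`: the original vertices of `G_𝓗`, together with
the subdivision vertices of the subdivided edges and the vertices of the two pendant paths.
* `sSS i j _ k`: the `k`-th of the `p-2` subdivision vertices of the edge `S_i S'_j`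
  (for `(i,j) ≠ (n,n)`);
* `sQS' x j _ k`: the `k`-th of the `p-2` subdivision vertices of the edge `q_x S'_j`
  (for `x ∈ S j`);
* `sQS x j _ k`: the `k`-th of the `p-1` subdivision vertices of the edge `q_x S_j`
  (for `x ∈ S j`);
* `sQQ x y _ k`: the `k`-th of the `p-1` subdivision vertices of the edge `q_x q_y`
  (for `x < y`);
* `pend1 k` / `pend2 k`: the `p-2` vertices of the pendant path of length `p-2` attached to
  `t1` / `t2`; its last vertex (index `p-3`) is `\bar{t}_1` / `\bar{t}_2`. -/
inductive BVert (m n p : ℕ) (S : Fin (n + 1) → Set (Fin m)) : Type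
  | orig : HVert m (n + 1) → BVert m n p S
  | sSS : (i j : Fin (n + 1)) → ¬(i = Fin.last n ∧ j = Fin.last n) → Fin (p - 2) →
      BVert m n p S
  | sQS' : (x : Fin m) → (j : Fin (n + 1)) → x ∈ S j → Fin (p - 2) → BVert m n p S
  | sQS : (x : Fin m) → (j : Fin (n + 1)) → x ∈ S j → Fin (p - 1) → BVert m n p S
  | sQQ : (x y : Fin m) → x < y → Fin (p - 1) → BVert m n p S
  | pend1 : Fin (p - 2) → BVert m n p S
  | pend2 : Fin (p - 2) → BVert m n p S

/-- The graph `\bar{G}_𝓗`, obtained from `G_𝓗` as follows: the edge `S_n S'_n` and all edges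
incident to `t1` or `t2` are kept; every other edge `S_i S'_j` and every edge between `Q` and
`𝒮'` is subdivided by exactly `p-2` new vertices (becoming a path of length `p-1`); every edge
inside `Q` and every edge between `Q` and `𝒮` is subdivided by exactly `p-1` new vertices
(becoming a path of length `p`); and a new path of length `p-2` is attached to each of `t1` and
`t2`, with other end-vertices `\bar{t}_1 = pend1 (p-3)` and `\bar{t}_2 = pend2 (p-3)`. -/
def barGH (m n p : ℕ) (S : Fin (n + 1) → Set (Fin m)) : SimpleGraph (BVert m n p S) :=
  SimpleGraph.fromRel (fun a b =>
    -- kept edges: t1 S_j, t2 S'_j, S_n S'_n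
    (∃ j : Fin (n + 1), a = .orig (.t1) ∧ b = .orig (.S j)) ∨
    (∃ j : Fin (n + 1), a = .orig (.t2) ∧ b = .orig (.S' j)) ∨
    (a = .orig (.S (Fin.last n)) ∧ b = .orig (.S' (Fin.last n))) ∨
    -- the subdivided edge S_i S'_j, (i,j) ≠ (n,n): a path S_i, v_0, …, v_{p-3}, S'_j
    (∃ (i j : Fin (n + 1)) (h : ¬(i = Fin.last n ∧ j = Fin.last n)) (k : Fin (p - 2)),
      (k : ℕ) = 0 ∧ a = .orig (.S i) ∧ b = .sSS i j h k) ∨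
    (∃ (i j : Fin (n + 1)) (h : ¬(i = Fin.last n ∧ j = Fin.last n)) (k k' : Fin (p - 2)),
      (k' : ℕ) = (k : ℕ) + 1 ∧ a = .sSS i j h k ∧ b = .sSS i j h k') ∨
    (∃ (i j : Fin (n + 1)) (h : ¬(i = Fin.last n ∧ j = Fin.last n)) (k : Fin (p - 2)),
      (k : ℕ) = p - 3 ∧ a = .sSS i j h k ∧ b = .orig (.S' j)) ∨
    -- the subdivided edge q_x S'_j, for x ∈ S j: a path q_x, v_0, …, v_{p-3}, S'_j
    (∃ (x : Fin m) (j : Fin (n + 1)) (hx : x ∈ S j) (k : Fin (p - 2)),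
      (k : ℕ) = 0 ∧ a = .orig (.q x) ∧ b = .sQS' x j hx k) ∨
    (∃ (x : Fin m) (j : Fin (n + 1)) (hx : x ∈ S j) (k k' : Fin (p - 2)),
      (k' : ℕ) = (k : ℕ) + 1 ∧ a = .sQS' x j hx k ∧ b = .sQS' x j hx k') ∨
    (∃ (x : Fin m) (j : Fin (n + 1)) (hx : x ∈ S j) (k : Fin (p - 2)),
      (k : ℕ) = p - 3 ∧ a = .sQS' x j hx k ∧ b = .orig (.S' j)) ∨
    -- the subdivided edge q_x S_j, for x ∈ S j: a path q_x, v_0, …, v_{p-2}, S_j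
    (∃ (x : Fin m) (j : Fin (n + 1)) (hx : x ∈ S j) (k : Fin (p - 1)),
      (k : ℕ) = 0 ∧ a = .orig (.q x) ∧ b = .sQS x j hx k) ∨
    (∃ (x : Fin m) (j : Fin (n + 1)) (hx : x ∈ S j) (k k' : Fin (p - 1)),
      (k' : ℕ) = (k : ℕ) + 1 ∧ a = .sQS x j hx k ∧ b = .sQS x j hx k') ∨
    (∃ (x : Fin m) (j : Fin (n + 1)) (hx : x ∈ S j) (k : Fin (p - 1)),
      (k : ℕ) = p - 2 ∧ a = .sQS x j hx k ∧ b = .orig (.S j)) ∨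
    -- the subdivided edge q_x q_y, for x < y: a path q_x, v_0, …, v_{p-2}, q_y
    (∃ (x y : Fin m) (hxy : x < y) (k : Fin (p - 1)),
      (k : ℕ) = 0 ∧ a = .orig (.q x) ∧ b = .sQQ x y hxy k) ∨
    (∃ (x y : Fin m) (hxy : x < y) (k k' : Fin (p - 1)),
      (k' : ℕ) = (k : ℕ) + 1 ∧ a = .sQQ x y hxy k ∧ b = .sQQ x y hxy k') ∨
    (∃ (x y : Fin m) (hxy : x < y) (k : Fin (p - 1)),
      (k : ℕ) = p - 2 ∧ a = .sQQ x y hxy k ∧ b = .orig (.q y)) ∨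
    -- the pendant path t1, pend1 0, …, pend1 (p-3) = \bar{t}_1
    (∃ k : Fin (p - 2), (k : ℕ) = 0 ∧ a = .orig (.t1) ∧ b = .pend1 k) ∨
    (∃ k k' : Fin (p - 2), (k' : ℕ) = (k : ℕ) + 1 ∧ a = .pend1 k ∧ b = .pend1 k') ∨
    -- the pendant path t2, pend2 0, …, pend2 (p-3) = \bar{t}_2
    (∃ k : Fin (p - 2), (k : ℕ) = 0 ∧ a = .orig (.t2) ∧ b = .pend2 k) ∨
    (∃ k k' : Fin (p - 2), (k' : ℕ) = (k : ℕ) + 1 ∧ a = .pend2 k ∧ b = .pend2 k'))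

/-- The closed subdivided path `a = c_0, c_1, …, c_{L+1} = b`, all of whose inner vertices `c_k`
have no neighbours outside the path, is contained in every set of vertices that has minimum degree
at least two and meets the interior of the path. -/
lemma chain_mem_of_inner_mem {V : Type*} {G : SimpleGraph V} {C : Set V}
    (hC : ∀ v ∈ C, ∃ x ∈ C, ∃ y ∈ C, x ≠ y ∧ G.Adj v x ∧ G.Adj v y)
    {L : ℕ} {c : ℕ → V}
    (hc : ∀ k < L, ∀ w, G.Adj (c (k + 1)) w → w = c k ∨ w = c (k + 2))
    {k : ℕ} (hk : k < L) (hmem : c (k + 1) ∈ C) : ∀ i ≤ L + 1, c i ∈ C := by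
  have step : ∀ k < L, c (k + 1) ∈ C → c k ∈ C ∧ c (k + 2) ∈ C := by
    intro k hk h
    obtain ⟨x, hx, y, hy, hxy, hax, hay⟩ := hC _ h
    rcases hc k hk x hax with rfl | rfl <;> rcases hc k hk y hay with rfl | rfl
    exacts [absurd rfl hxy, ⟨hx, hy⟩, ⟨hy, hx⟩, absurd rfl hxy]
  have up : ∀ d, k + 1 + d ≤ L + 1 → c (k + 1 + d) ∈ C := by
    intro d
    induction d with
    | zero => exact fun _ => hmem
    | succ d ih =>
      intro h
      have := (step (k + d) (by omega) (by convert ih (by omega) using 2; omega)).2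
      convert this using 2
      omega
  have down : ∀ d ≤ k + 1, c (k + 1 - d) ∈ C := by
    intro d
    induction d with
    | zero => exact fun _ => hmem
    | succ d ih =>
      intro h
      have := (step (k - d) (by omega) (by convert ih (by omega) using 2; omega)).1
      convert this using 2
      omega
  intro i hi
  rcases le_total i (k + 1) with h | h
  · convert down (k + 1 - i) (by omega) using 2
    omega
  · convert up (i - (k + 1)) (by omega) using 2
    omega

lemma notMem_of_unique_adj {V : Type*} {G : SimpleGraph V} {C : Set V}
    (hC : ∀ v ∈ C, ∃ x ∈ C, ∃ y ∈ C, x ≠ y ∧ G.Adj v x ∧ G.Adj v y) {v : V} (a : V)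
    (h : ∀ x ∈ C, G.Adj v x → x = a) : v ∉ C := by
  intro hv
  obtain ⟨x, hx, y, hy, hxy, hax, hay⟩ := hC v hv
  exact hxy ((h x hx hax).trans (h y hy hay).symm)

lemma SimpleGraph.Walk.IsCycle.exists_two_adj {V : Type*} {G : SimpleGraph V} {u : V}
    {w : G.Walk u u} (hw : w.IsCycle) :
    ∀ v ∈ {v | v ∈ w.support}, ∃ x ∈ {v | v ∈ w.support}, ∃ y ∈ {v | v ∈ w.support},
      x ≠ y ∧ G.Adj v x ∧ G.Adj v y := by
  intro v hv
  obtain ⟨x, y, hxy, h⟩ := Set.ncard_eq_two.1 (hw.ncard_neighborSet_toSubgraph_eq_two hv)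
  have hx : w.toSubgraph.Adj v x := by
    rw [← Subgraph.mem_neighborSet, h]; simp
  have hy : w.toSubgraph.Adj v y := by
    rw [← Subgraph.mem_neighborSet, h]; simp
  exact ⟨x, by simpa using hx.snd_mem, y, by simpa using hy.snd_mem, hxy, hx.adj_sub, hy.adj_sub⟩

lemma SimpleGraph.Walk.IsCycle.le_length_of_injOn {V : Type*} {G : SimpleGraph V} {u : V}
    {w : G.Walk u u} (hw : w.IsCycle) {N : ℕ} {c : ℕ → V} (hinj : Set.InjOn c (Set.Iio N))
    (hmem : ∀ i < N, c i ∈ w.support) : N ≤ w.length := by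
  classical
  have hsub : (Finset.range N).image c ⊆ w.support.tail.toFinset := by
    intro v hv
    obtain ⟨i, hi, rfl⟩ := Finset.mem_image.1 hv
    have := hmem i (Finset.mem_range.1 hi)
    rw [List.mem_toFinset]
    rcases (Walk.mem_support_iff w).1 this with h | h
    · rw [h]
      exact Walk.end_mem_tail_support hw.not_nil
    · exact h
  have h1 := Finset.card_le_card hsub
  rw [Finset.card_image_of_injOn (by simpa [Set.InjOn] using hinj), Finset.card_range] at h1
  have h2 := List.toFinset_card_le w.support.tail
  simp at h2
  omega

/-- A path `a, s 0, …, s (L - 1), b`, as a function on `ℕ`. -/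
def chain {V : Type*} {L : ℕ} (a b : V) (s : Fin L → V) (i : ℕ) : V :=
  if i = 0 then a else if h : i - 1 < L then s ⟨i - 1, h⟩ else b

lemma chain_succ {V : Type*} {L : ℕ} (a b : V) (s : Fin L → V) (k : Fin L) :
    chain a b s (k + 1) = s k := by
  simp [chain]

lemma chain_injOn {V : Type*} {L : ℕ} {a b : V} {s : Fin L → V} (hab : a ≠ b)
    (hs : Function.Injective s) (ha : ∀ k, s k ≠ a) (hb : ∀ k, s k ≠ b) :
    Set.InjOn (chain a b s) (Set.Iio (L + 2)) := by
  intro i hi j hj h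
  simp only [Set.mem_Iio] at hi hj
  unfold chain at h
  split_ifs at h
  all_goals first
    | omega
    | exact absurd h hab
    | exact absurd h.symm hab
    | exact absurd h (ha _)
    | exact absurd h.symm (ha _)
    | exact absurd h (hb _)
    | exact absurd h.symm (hb _)
    | (have := congrArg Fin.val (hs h); simp at this; omega)

/-- A cycle through an inner vertex of a subdivided edge with `L` inner vertices has length at
least `L + 2`. -/
lemma SimpleGraph.Walk.IsCycle.le_length_of_chain {V : Type*} {G : SimpleGraph V} {u : V}
    {w : G.Walk u u} (hw : w.IsCycle) {L : ℕ} {a b : V} {s : Fin L → V} (hab : a ≠ b)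
    (hs : Function.Injective s) (ha : ∀ k, s k ≠ a) (hb : ∀ k, s k ≠ b)
    (hadj : ∀ k v, G.Adj (s k) v → v = chain a b s k ∨ v = chain a b s (k + 2))
    (k : Fin L) (hk : s k ∈ w.support) : L + 2 ≤ w.length := by
  refine hw.le_length_of_injOn (chain_injOn hab hs ha hb) fun i hi => ?_
  refine chain_mem_of_inner_mem hw.exists_two_adj (c := chain a b s) (L := L) ?_ k.2 ?_ i
    (by omega)
  · intro j hj v hv
    exact hadj ⟨j, hj⟩ v (by rwa [← chain_succ a b s ⟨j, hj⟩])
  · rwa [chain_succ]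

section barGH

variable {m n p : ℕ} {S : Fin (n + 1) → Set (Fin m)}

lemma barGH_adj_sSS {i j : Fin (n + 1)} {h : ¬(i = Fin.last n ∧ j = Fin.last n)}
    (k : Fin (p - 2)) (v : BVert m n p S) (hv : (barGH m n p S).Adj (.sSS i j h k) v) :
    v = chain (.orig (.S i)) (.orig (.S' j)) (.sSS i j h) k ∨
      v = chain (.orig (.S i)) (.orig (.S' j)) (.sSS i j h) (k + 2) := by
  simp only [barGH, fromRel_adj] at hv
  have := k.2
  cases v <;> simp at hv <;> simp [chain] <;> grind

lemma barGH_adj_sQS' {x : Fin m} {j : Fin (n + 1)} {h : x ∈ S j}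
    (k : Fin (p - 2)) (v : BVert m n p S) (hv : (barGH m n p S).Adj (.sQS' x j h k) v) :
    v = chain (.orig (.q x)) (.orig (.S' j)) (.sQS' x j h) k ∨
      v = chain (.orig (.q x)) (.orig (.S' j)) (.sQS' x j h) (k + 2) := by
  simp only [barGH, fromRel_adj] at hv
  have := k.2
  cases v <;> simp at hv <;> simp [chain] <;> grind

lemma barGH_adj_sQS {x : Fin m} {j : Fin (n + 1)} {h : x ∈ S j}
    (k : Fin (p - 1)) (v : BVert m n p S) (hv : (barGH m n p S).Adj (.sQS x j h k) v) :
    v = chain (.orig (.q x)) (.orig (.S j)) (.sQS x j h) k ∨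
      v = chain (.orig (.q x)) (.orig (.S j)) (.sQS x j h) (k + 2) := by
  simp only [barGH, fromRel_adj] at hv
  have := k.2
  cases v <;> simp at hv <;> simp [chain] <;> grind

lemma barGH_adj_sQQ {x y : Fin m} {h : x < y}
    (k : Fin (p - 1)) (v : BVert m n p S) (hv : (barGH m n p S).Adj (.sQQ x y h k) v) :
    v = chain (.orig (.q x)) (.orig (.q y)) (.sQQ x y h) k ∨
      v = chain (.orig (.q x)) (.orig (.q y)) (.sQQ x y h) (k + 2) := by
  simp only [barGH, fromRel_adj] at hv
  have := k.2
  cases v <;> simp at hv <;> simp [chain] <;> grind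

lemma barGH_adj_pend1 (k : Fin (p - 2)) (v : BVert m n p S)
    (hv : (barGH m n p S).Adj (.pend1 k) v) :
    v = chain (.orig .t1) (.orig .t1) .pend1 k ∨
      ∃ k' : Fin (p - 2), (k' : ℕ) = k + 1 ∧ v = .pend1 k' := by
  simp only [barGH, fromRel_adj] at hv
  have := k.2
  cases v <;> simp at hv <;> simp [chain] <;> grind

lemma barGH_pend1_notMem {C : Set (BVert m n p S)}
    (hC : ∀ v ∈ C, ∃ x ∈ C, ∃ y ∈ C, x ≠ y ∧ (barGH m n p S).Adj v x ∧ (barGH m n p S).Adj v y)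
    (k : Fin (p - 2)) : .pend1 k ∉ C := by
  induction hd : p - 2 - k using Nat.strong_induction_on generalizing k with
  | _ d ih =>
    refine notMem_of_unique_adj hC (chain (.orig .t1) (.orig .t1) .pend1 k)
      fun v hv hadj => ?_
    obtain h | ⟨k', hk', rfl⟩ := barGH_adj_pend1 k v hadj
    · exact h
    · exact absurd hv (ih _ (by omega) k' rfl)

lemma barGH_adj_pend2 (k : Fin (p - 2)) (v : BVert m n p S)
    (hv : (barGH m n p S).Adj (.pend2 k) v) :
    v = chain (.orig .t2) (.orig .t2) .pend2 k ∨
      ∃ k' : Fin (p - 2), (k' : ℕ) = k + 1 ∧ v = .pend2 k' := by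
  simp only [barGH, fromRel_adj] at hv
  have := k.2
  cases v <;> simp at hv <;> simp [chain] <;> grind

lemma barGH_pend2_notMem {C : Set (BVert m n p S)}
    (hC : ∀ v ∈ C, ∃ x ∈ C, ∃ y ∈ C, x ≠ y ∧ (barGH m n p S).Adj v x ∧ (barGH m n p S).Adj v y)
    (k : Fin (p - 2)) : .pend2 k ∉ C := by
  induction hd : p - 2 - k using Nat.strong_induction_on generalizing k with
  | _ d ih =>
    refine notMem_of_unique_adj hC (chain (.orig .t2) (.orig .t2) .pend2 k)
      fun v hv hadj => ?_
    obtain h | ⟨k', hk', rfl⟩ := barGH_adj_pend2 k v hadj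
    · exact h
    · exact absurd hv (ih _ (by omega) k' rfl)

lemma barGH_adj_orig {a b : HVert m (n + 1)}
    (h : (barGH m n p S).Adj (.orig a) (.orig b)) :
    (∃ j, s(a, b) = s(.t1, .S j)) ∨ (∃ j, s(a, b) = s(.t2, .S' j)) ∨
      s(a, b) = s(.S (Fin.last n), .S' (Fin.last n)) := by
  simp [barGH] at h
  grind

/-- A set of vertices of minimum degree at least two meets the interior of a subdivided edge. -/
lemma barGH_exists_subdivision_mem {C : Set (BVert m n p S)}
    (hC : ∀ v ∈ C, ∃ x ∈ C, ∃ y ∈ C, x ≠ y ∧ (barGH m n p S).Adj v x ∧ (barGH m n p S).Adj v y)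
    (hne : C.Nonempty) :
    (∃ i j h k, .sSS i j h k ∈ C) ∨ (∃ x j h k, .sQS' x j h k ∈ C) ∨
      (∃ x j h k, .sQS x j h k ∈ C) ∨ (∃ x y h k, .sQQ x y h k ∈ C) := by
  by_contra hno
  simp only [not_or, not_exists] at hno
  obtain ⟨h1, h2, h3, h4⟩ := hno
  have hp1 := barGH_pend1_notMem hC
  have hp2 := barGH_pend2_notMem hC
  have horig : ∀ v ∈ C, ∃ b, v = .orig b := by
    rintro (b | _ | _ | _ | _ | _ | _) hv
    exacts [⟨b, rfl⟩, absurd hv (h1 _ _ _ _), absurd hv (h2 _ _ _ _), absurd hv (h3 _ _ _ _),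
      absurd hv (h4 _ _ _ _), absurd hv (hp1 _), absurd hv (hp2 _)]
  have hq : ∀ x, .orig (.q x) ∉ C := by
    intro x
    refine notMem_of_unique_adj hC (.orig .t1) fun v hv hadj => ?_
    obtain ⟨b, rfl⟩ := horig v hv
    have := barGH_adj_orig hadj
    grind
  have hS : ∀ j ≠ Fin.last n, .orig (.S j) ∉ C := by
    intro j hj
    refine notMem_of_unique_adj hC (.orig .t1) fun v hv hadj => ?_
    obtain ⟨b, rfl⟩ := horig v hv
    have := barGH_adj_orig hadj
    grind
  have hS' : ∀ j ≠ Fin.last n, .orig (.S' j) ∉ C := by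
    intro j hj
    refine notMem_of_unique_adj hC (.orig .t2) fun v hv hadj => ?_
    obtain ⟨b, rfl⟩ := horig v hv
    have := barGH_adj_orig hadj
    grind
  have ht1 : .orig .t1 ∉ C := by
    refine notMem_of_unique_adj hC (.orig (.S (Fin.last n))) fun v hv hadj => ?_
    obtain ⟨b, rfl⟩ := horig v hv
    have := barGH_adj_orig hadj
    grind
  have ht2 : .orig .t2 ∉ C := by
    refine notMem_of_unique_adj hC (.orig (.S' (Fin.last n))) fun v hv hadj => ?_
    obtain ⟨b, rfl⟩ := horig v hv
    have := barGH_adj_orig hadj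
    grind
  have hSn : .orig (.S (Fin.last n)) ∉ C := by
    refine notMem_of_unique_adj hC (.orig (.S' (Fin.last n))) fun v hv hadj => ?_
    obtain ⟨b, rfl⟩ := horig v hv
    have := barGH_adj_orig hadj
    grind
  have hSn' : .orig (.S' (Fin.last n)) ∉ C := by
    refine notMem_of_unique_adj hC (.orig (.S (Fin.last n))) fun v hv hadj => ?_
    obtain ⟨b, rfl⟩ := horig v hv
    have := barGH_adj_orig hadj
    grind
  obtain ⟨v, hv⟩ := hne
  obtain ⟨_ | j | j | _ | _, rfl⟩ := horig v hv
  · exact hq _ hv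
  · rcases eq_or_ne j (Fin.last n) with rfl | hj
    exacts [hSn hv, hS j hj hv]
  · rcases eq_or_ne j (Fin.last n) with rfl | hj
    exacts [hSn' hv, hS' j hj hv]
  exacts [ht1 hv, ht2 hv]

lemma barGH_le_length_of_isCycle {u : BVert m n p S} {w : (barGH m n p S).Walk u u}
    (hw : w.IsCycle) : p ≤ w.length := by
  rcases barGH_exists_subdivision_mem hw.exists_two_adj ⟨u, w.start_mem_support⟩ with
    ⟨i, j, h, k, hk⟩ | ⟨x, j, h, k, hk⟩ | ⟨x, j, h, k, hk⟩ | ⟨x, y, h, k, hk⟩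
  · have := hw.le_length_of_chain (by simp) (fun _ _ => by simp) (by simp) (by simp)
      barGH_adj_sSS k hk
    omega
  · have := hw.le_length_of_chain (by simp) (fun _ _ => by simp) (by simp) (by simp)
      barGH_adj_sQS' k hk
    omega
  · have := hw.le_length_of_chain (by simp) (fun _ _ => by simp) (by simp) (by simp)
      barGH_adj_sQS k hk
    omega
  · have := hw.le_length_of_chain (by simpa using h.ne) (fun _ _ => by simp) (by simp) (by simp)
      barGH_adj_sQQ k hk
    omega

/-- The parity of this number is a proper 2-colouring of `barGH` for even `p`. -/
def BVert.parity : BVert m n p S → ℕ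
  | .orig (.q _) => 1
  | .orig (.S _) => 1
  | .orig (.S' _) => 0
  | .orig .t1 => 0
  | .orig .t2 => 1
  | .sSS _ _ _ k => k
  | .sQS' _ _ _ k => k
  | .sQS _ _ _ k => k
  | .sQQ _ _ _ k => k
  | .pend1 k => k + 1
  | .pend2 k => k

lemma barGH_parity_ne (hp : 4 ≤ p) (hpe : Even p) {u v : BVert m n p S}
    (h : (barGH m n p S).Adj u v) : u.parity % 2 ≠ v.parity % 2 := by
  obtain ⟨r, rfl⟩ := hpe
  simp only [barGH, fromRel_adj] at h
  rcases h.2 with h | h <;>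
  rcases h with ⟨_, rfl, rfl⟩ | ⟨_, rfl, rfl⟩ | ⟨rfl, rfl⟩ |
    ⟨_, _, _, _, hk, rfl, rfl⟩ | ⟨_, _, _, _, _, hk, rfl, rfl⟩ | ⟨_, _, _, _, hk, rfl, rfl⟩ |
    ⟨_, _, _, _, hk, rfl, rfl⟩ | ⟨_, _, _, _, _, hk, rfl, rfl⟩ | ⟨_, _, _, _, hk, rfl, rfl⟩ |
    ⟨_, _, _, _, hk, rfl, rfl⟩ | ⟨_, _, _, _, _, hk, rfl, rfl⟩ | ⟨_, _, _, _, hk, rfl, rfl⟩ |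
    ⟨_, _, _, _, hk, rfl, rfl⟩ | ⟨_, _, _, _, _, hk, rfl, rfl⟩ | ⟨_, _, _, _, hk, rfl, rfl⟩ |
    ⟨_, hk, rfl, rfl⟩ | ⟨_, _, hk, rfl, rfl⟩ | ⟨_, hk, rfl, rfl⟩ | ⟨_, _, hk, rfl, rfl⟩ <;>
  simp only [BVert.parity] <;> omega

/-- A function changing by at most one along every edge of `barGH`, which on a shortest path
between the ends of the two pendant paths is the distance from the end of the first one. -/
def BVert.level : BVert m n p S → ℕ
  | .orig (.q _) => p - 1
  | .orig (.S _) => p - 1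
  | .orig (.S' _) => p
  | .orig .t1 => p - 2
  | .orig .t2 => p + 1
  | .sSS _ _ _ _ => p - 1
  | .sQS' _ _ _ _ => p - 1
  | .sQS _ _ _ _ => p - 1
  | .sQQ _ _ _ _ => p - 1
  | .pend1 k => p - 3 - k
  | .pend2 k => p + 2 + k

lemma barGH_level_le (hp : 4 ≤ p) {u v : BVert m n p S}
    (h : (barGH m n p S).Adj u v) : v.level ≤ u.level + 1 := by
  simp only [barGH, fromRel_adj] at h
  rcases h.2 with h | h <;>
  rcases h with ⟨_, rfl, rfl⟩ | ⟨_, rfl, rfl⟩ | ⟨rfl, rfl⟩ |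
    ⟨_, _, _, _, hk, rfl, rfl⟩ | ⟨_, _, _, _, _, hk, rfl, rfl⟩ | ⟨_, _, _, _, hk, rfl, rfl⟩ |
    ⟨_, _, _, _, hk, rfl, rfl⟩ | ⟨_, _, _, _, _, hk, rfl, rfl⟩ | ⟨_, _, _, _, hk, rfl, rfl⟩ |
    ⟨_, _, _, _, hk, rfl, rfl⟩ | ⟨_, _, _, _, _, hk, rfl, rfl⟩ | ⟨_, _, _, _, hk, rfl, rfl⟩ |
    ⟨_, _, _, _, hk, rfl, rfl⟩ | ⟨_, _, _, _, _, hk, rfl, rfl⟩ | ⟨_, _, _, _, hk, rfl, rfl⟩ |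
    ⟨_, hk, rfl, rfl⟩ | ⟨_, _, hk, rfl, rfl⟩ | ⟨_, hk, rfl, rfl⟩ | ⟨_, _, hk, rfl, rfl⟩ <;>
  simp only [BVert.level] <;> omega

lemma barGH_level_le_add_length (hp : 4 ≤ p) {u v : BVert m n p S}
    (w : (barGH m n p S).Walk u v) : v.level ≤ u.level + w.length := by
  induction w with
  | nil => simp
  | cons h _ ih =>
    have := barGH_level_le hp h
    rw [Walk.length_cons]
    omega

lemma barGH_exists_walk_pend1 (k : ℕ) (hk : k < p - 2) :
    ∃ w : (barGH m n p S).Walk (.orig .t1) (.pend1 ⟨k, hk⟩), w.length = k + 1 := by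
  induction k with
  | zero => exact ⟨Walk.cons (by simp [barGH]) .nil, rfl⟩
  | succ k ih =>
    obtain ⟨w, hw⟩ := ih (by omega)
    exact ⟨w.concat (by simp [barGH]), by simp [hw]⟩

lemma barGH_exists_walk_pend2 (k : ℕ) (hk : k < p - 2) :
    ∃ w : (barGH m n p S).Walk (.orig .t2) (.pend2 ⟨k, hk⟩), w.length = k + 1 := by
  induction k with
  | zero => exact ⟨Walk.cons (by simp [barGH]) .nil, rfl⟩
  | succ k ih =>
    obtain ⟨w, hw⟩ := ih (by omega)
    exact ⟨w.concat (by simp [barGH]), by simp [hw]⟩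

lemma barGH_exists_walk_t1_t2 :
    ∃ w : (barGH m n p S).Walk (.orig .t1) (.orig .t2), w.length = 3 :=
  ⟨.cons (v := .orig (.S (Fin.last n))) (by simp [barGH])
    (.cons (v := .orig (.S' (Fin.last n))) (by simp [barGH]) (.cons (by simp [barGH]) .nil)), rfl⟩

end barGH

theorem stmt_18 (m n p : ℕ) (hp : 4 ≤ p) (hpe : Even p)
    (S : Fin (n + 1) → Set (Fin m))
    (hS : ∀ j, (S j).Nonempty) (hlast : S (Fin.last n) = Set.univ) :
    -- `\bar{G}_𝓗` is bipartite
    (barGH m n p S).Colorable 2 ∧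
    -- `\bar{G}_𝓗` has girth at least `p`
    (p : ℕ∞) ≤ (barGH m n p S).egirth ∧
    -- the distance between `\bar{t}_1` and `\bar{t}_2` equals `2p - 1`
    (barGH m n p S).dist (.pend1 ⟨p - 3, by omega⟩) (.pend2 ⟨p - 3, by omega⟩)
      = 2 * p - 1 := by
  refine ⟨⟨Coloring.mk (fun v => (⟨v.parity % 2, Nat.mod_lt _ two_pos⟩ : Fin 2)) ?_⟩, ?_, ?_⟩
  · intro u v h
    simpa using barGH_parity_ne hp hpe h
  · rw [le_egirth]
    exact fun _ _ hw => Nat.cast_le.2 (barGH_le_length_of_isCycle hw)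
  · obtain ⟨w₁, h₁⟩ := barGH_exists_walk_pend1 (m := m) (n := n) (S := S) (p - 3)
      (by omega : p - 3 < p - 2)
    obtain ⟨w₂, h₂⟩ := barGH_exists_walk_pend2 (m := m) (n := n) (S := S) (p - 3)
      (by omega : p - 3 < p - 2)
    obtain ⟨w₀, h₀⟩ := barGH_exists_walk_t1_t2 (m := m) (n := n) (p := p) (S := S)
    let w := w₁.reverse.append (w₀.append w₂)
    have hle := dist_le w
    have hlen : w.length = 2 * p - 1 := by
      simp only [w, Walk.length_append, Walk.length_reverse, h₀, h₁, h₂]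
      omega
    obtain ⟨w', hw'⟩ := w.reachable.exists_walk_length_eq_dist
    have hge := barGH_level_le_add_length hp w'
    simp only [BVert.level] at hge
    omega
end
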